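/- arXiv:1707.08734 — 3 statements merged into one kernel-verified Lean document; each statement's English description precedes it below -/
import Mathlib

section
/- Let G be a subset of the set of agents A with |G| ≥ 3. Then for every call sequence σ and every formula φ of L^ck, (M, σ) ⊨ C_G φ if and only if M ⊨ φ (i.e., common knowledge among three or more agents of a formula holds at some call sequence exactly when the formula is true at every call sequence). -/
namespace Gossip

/-- A call between two distinct agents. -/
structure Call (A : Type) where
  x : A
  y : A
  ne : x ≠ y

variable {A : Type} [DecidableEq A]

/-- Agent `a` is involved in the call `c`. -/
def Call.involves (c : Call A) (a : A) : Prop := a = c.x ∨ a = c.y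

instance (c : Call A) (a : A) : Decidable (c.involves a) := by
  unfold Call.involves; infer_instance

/-- `c` is the call between agents `a` and `b`. -/
def Call.isBetween (c : Call A) (a b : A) : Prop :=
  (c.x = a ∧ c.y = b) ∨ (c.x = b ∧ c.y = a)

instance (c : Call A) (a b : A) : Decidable (c.isBetween a b) := by
  unfold Call.isBetween; infer_instance

/-- The effect of a call on a gossip situation: the two agents involved
pool their secrets. -/
def Call.apply (c : Call A) (s : A → Finset A) : A → Finset A :=
  fun d => if d = c.x ∨ d = c.y then s c.x ∪ s c.y else s d

/-- The initial gossip situation: each agent is familiar only with their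
own secret (secrets are identified with agents via the fixed bijection). -/
def root : A → Finset A := fun a => {a}

/-- The result of applying a call sequence to a gossip situation. -/
def applySeq (σ : List (Call A)) (s : A → Finset A) : A → Finset A :=
  σ.foldl (fun t c => c.apply t) s

/-- `∼_a` : the smallest relation with `ε ∼_a ε`, closed under appending
calls not involving `a` on either side, and under appending a call
involving `a` on both sides when it yields the same set of secrets for `a`. -/
inductive AgEquiv (a : A) : List (Call A) → List (Call A) → Prop
  | nil : AgEquiv a [] []
  | extLeft {σ τ : List (Call A)} (c : Call A) :
      ¬ c.involves a → AgEquiv a σ τ → AgEquiv a (σ ++ [c]) τ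
  | extRight {σ τ : List (Call A)} (c : Call A) :
      ¬ c.involves a → AgEquiv a σ τ → AgEquiv a σ (τ ++ [c])
  | call {σ τ : List (Call A)} (c : Call A) :
      c.involves a →
      applySeq (σ ++ [c]) root a = applySeq (τ ++ [c]) root a →
      AgEquiv a σ τ → AgEquiv a (σ ++ [c]) (τ ++ [c])

/-- `∼_G` : reflexive-transitive closure of the union of the `∼_a`, `a ∈ G`. -/
def GEquiv (G : Finset A) : List (Call A) → List (Call A) → Prop :=
  Relation.ReflTransGen (fun σ τ => ∃ a ∈ G, AgEquiv a σ τ)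

/-- Formulas of the language `L^ck`. `fam a p` is `F_a p`,
`ck G φ` is `C_G φ`; `K_a φ` is `ck {a} φ`. -/
inductive Formula (A : Type) where
  | fam : A → A → Formula A
  | neg : Formula A → Formula A
  | conj : Formula A → Formula A → Formula A
  | ck : Finset A → Formula A → Formula A

/-- Truth of a formula at a call sequence (in the gossip model). -/
def Sat : Formula A → List (Call A) → Prop
  | .fam a p, σ => p ∈ applySeq σ root a
  | .neg φ, σ => ¬ Sat φ σ
  | .conj φ ψ, σ => Sat φ σ ∧ Sat ψ σ
  | .ck G φ, σ => ∀ τ, GEquiv G σ τ → Sat φ τ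

/-- `M ⊨ φ` : truth at every call sequence. -/
def Truth (φ : Formula A) : Prop := ∀ σ : List (Call A), Sat φ σ

/-- Formulas with no occurrence of the negation symbol. -/
def NegFree : Formula A → Prop
  | .fam _ _ => True
  | .neg _ => False
  | .conj φ ψ => NegFree φ ∧ NegFree ψ
  | .ck _ φ => NegFree φ

/-- Formulas with no occurrence of the `C_G` modalities (propositional part). -/
def CkFree : Formula A → Prop
  | .fam _ _ => True
  | .neg φ => CkFree φ
  | .conj φ ψ => CkFree φ ∧ CkFree ψ
  | .ck _ _ => False

/-- Formulas of `L_wn`: no nested occurrence of the `C_G` modalities. -/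
def NoNested : Formula A → Prop
  | .fam _ _ => True
  | .neg φ => NoNested φ
  | .conj φ ψ => NoNested φ ∧ NoNested ψ
  | .ck _ φ => CkFree φ

/-- The call `ab` occurs in `σ`. -/
def occursBetween (a b : A) (σ : List (Call A)) : Prop :=
  ∃ c ∈ σ, c.isBetween a b

/-- Epistemic pair-view component `Ṽ(σ)(a,b)`. -/
def pairView (σ : List (Call A)) (a b : A) : Set (A → Finset A) :=
  {s | ∃ τ, GEquiv {a, b} σ τ ∧ s = applySeq τ root}

/-- The full epistemic pair-view `Ṽ(σ)` : all components `Ṽ(σ)(a,b)`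
together with the designated situation `Ṽ(σ)(*) = σ(root)`. -/
def fullView (σ : List (Call A)) : (A → A → Set (A → Finset A)) × (A → Finset A) :=
  (pairView σ, applySeq σ root)

/-- A call sequence is pair-epistemically non-redundant if no nonempty
subsequence `σ₂` of a prefix `σ₁.σ₂` is pair-epistemically redundant. -/
def PairNonRedundant (σ : List (Call A)) : Prop :=
  ∀ σ₁ σ₂ : List (Call A), (σ₁ ++ σ₂) <+: σ → σ₂ ≠ [] →
    fullView σ₁ ≠ fullView (σ₁ ++ σ₂)

/-- Order on gossip situations: componentwise inclusion. -/
def gsLE (s t : A → Finset A) : Prop := ∀ a, s a ⊆ t a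

/-- The order `≤_EPV` on (the pair components of) epistemic pair-views. -/
def epvLE (V W : A → A → Set (A → Finset A)) : Prop :=
  ∀ a b : A, ∃ X : Set (A → Finset A), X ⊆ V a b ∧
    ∃ g : X → W a b, Function.Surjective g ∧ ∀ s : X, gsLE s.1 (g s).1

/-- `σ` is ab-redundant free: no call of `σ` different from the call `ab`
is redundant (leaves the current gossip situation unchanged). -/
def abRedundantFree (a b : A) (σ : List (Call A)) : Prop :=
  ∀ (i : ℕ) (h : i < σ.length), ¬ (σ.get ⟨i, h⟩).isBetween a b →
    (σ.get ⟨i, h⟩).apply (applySeq (σ.take i) root) ≠ applySeq (σ.take i) root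

theorem AgEquiv.refl (a : A) (σ : List (Call A)) : AgEquiv a σ σ := by
  induction σ using List.reverseRecOn with
  | nil => exact .nil
  | append_singleton σ c ih =>
    by_cases h : c.involves a
    · exact .call c h rfl ih
    · exact .extLeft c h (.extRight c h ih)

theorem AgEquiv.symm {a : A} {σ τ : List (Call A)} (h : AgEquiv a σ τ) : AgEquiv a τ σ := by
  induction h with
  | nil => exact .nil
  | extLeft c hc _ ih => exact .extRight c hc ih
  | extRight c hc _ ih => exact .extLeft c hc ih
  | call c hc he _ ih => exact .call c hc he.symm ih

theorem GEquiv.symm {G : Finset A} {σ τ : List (Call A)} (h : GEquiv G σ τ) : GEquiv G τ σ := by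
  induction h with
  | refl => exact .refl
  | tail _ hstep ih =>
    obtain ⟨a, ha, hst⟩ := hstep
    exact .head ⟨a, ha, hst.symm⟩ ih

/-- Among three or more agents, some agent takes no part in a given call. -/
theorem exists_mem_not_involves {G : Finset A} (hG : 3 ≤ G.card) (c : Call A) :
    ∃ a ∈ G, ¬ c.involves a := by
  have hlt : ({c.x, c.y} : Finset A).card < G.card := Finset.card_le_two.trans_lt hG
  obtain ⟨a, ha, hna⟩ := Finset.exists_mem_notMem_of_card_lt_card hlt
  exact ⟨a, ha, by simpa [Call.involves] using hna⟩

/-- Some agent of `G` misses the last call, so calls can be removed one by one. -/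
theorem gEquiv_nil {G : Finset A} (hG : 3 ≤ G.card) (σ : List (Call A)) : GEquiv G σ [] := by
  induction σ using List.reverseRecOn with
  | nil => exact .refl
  | append_singleton σ c ih =>
    obtain ⟨a, ha, hc⟩ := exists_mem_not_involves hG c
    exact .head ⟨a, ha, .extLeft c hc (.refl a σ)⟩ ih

theorem stmt0 {A : Type} [DecidableEq A] [Fintype A] (hA : 3 ≤ Fintype.card A)
    (G : Finset A) (hG : 3 ≤ G.card) (σ : List (Call A)) (φ : Formula A) :
    Sat (Formula.ck G φ) σ ↔ Truth φ := by
  refine ⟨fun h τ => ?_, fun h τ _ => h τ⟩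
  simp only [Sat] at h
  exact h τ ((gEquiv_nil hG σ).trans (gEquiv_nil hG τ).symm)

end Gossip
end

section
/- (Monotonicity) Let φ be a formula of L^ck that contains no occurrence of the negation symbol ¬. If σ ⊑ τ (τ extends σ) and (M, σ) ⊨ φ, then (M, τ) ⊨ φ. -/
namespace Gossip

variable {A : Type} [DecidableEq A]

theorem subset_applySeq (σ : List (Call A)) (s : A → Finset A) (a : A) :
    s a ⊆ applySeq σ s a := by
  induction σ generalizing s with
  | nil => exact Finset.Subset.refl _
  | cons c σ ih =>
    refine Finset.Subset.trans ?_ (ih (c.apply s))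
    unfold Call.apply
    split_ifs with hc
    · rcases hc with rfl | rfl
      · exact Finset.subset_union_left
      · exact Finset.subset_union_right
    · exact Finset.Subset.refl _

theorem applySeq_mono {σ τ : List (Call A)} (hpre : σ <+: τ) (s : A → Finset A) (a : A) :
    applySeq σ s a ⊆ applySeq τ s a := by
  obtain ⟨ρ, rfl⟩ := hpre
  rw [applySeq, applySeq, List.foldl_append]
  exact subset_applySeq ρ _ a

/-- A prefix of `τ` is `∼_a`-equivalent to some prefix of any sequence equivalent to `τ`. -/
theorem AgEquiv.exists_prefix {a : A} {τ τ' : List (Call A)} (h : AgEquiv a τ τ') :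
    ∀ σ, σ <+: τ → ∃ σ', σ' <+: τ' ∧ AgEquiv a σ σ' := by
  induction h with
  | nil =>
    intro σ hσ
    obtain rfl := List.prefix_nil.mp hσ
    exact ⟨[], hσ, .nil⟩
  | extLeft c hc h ih =>
    intro σ hσ
    rcases List.prefix_concat_iff.mp hσ with rfl | hσ
    · exact ⟨_, List.prefix_rfl, .extLeft c hc h⟩
    · exact ih σ hσ
  | extRight c hc h ih =>
    intro σ hσ
    obtain ⟨σ', hσ', hσσ'⟩ := ih σ hσ
    exact ⟨σ', hσ'.trans (List.prefix_append _ _), hσσ'⟩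
  | call c hc heq h ih =>
    intro σ hσ
    rcases List.prefix_concat_iff.mp hσ with rfl | hσ
    · exact ⟨_, List.prefix_rfl, .call c hc heq h⟩
    · obtain ⟨σ', hσ', hσσ'⟩ := ih σ hσ
      exact ⟨σ', hσ'.trans (List.prefix_append _ _), hσσ'⟩

theorem GEquiv.exists_prefix {G : Finset A} {σ τ τ' : List (Call A)} (h : GEquiv G τ τ')
    (hpre : σ <+: τ) : ∃ σ', σ' <+: τ' ∧ GEquiv G σ σ' := by
  induction h with
  | refl => exact ⟨σ, hpre, .refl⟩
  | tail _ hstep ih =>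
    obtain ⟨ρ, hρ, hσρ⟩ := ih
    obtain ⟨a, ha, hstep⟩ := hstep
    obtain ⟨ρ', hρ', hρρ'⟩ := hstep.exists_prefix ρ hρ
    exact ⟨ρ', hρ', hσρ.tail ⟨a, ha, hρρ'⟩⟩

theorem stmt2 {A : Type} [DecidableEq A] [Fintype A] (hA : 3 ≤ Fintype.card A)
    (φ : Formula A) (hφ : NegFree φ) (σ τ : List (Call A))
    (hpre : σ <+: τ) (h : Sat φ σ) : Sat φ τ := by
  induction φ generalizing σ τ with
  | fam a p => exact applySeq_mono hpre root a h
  | neg φ => exact hφ.elim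
  | conj φ ψ ihφ ihψ => exact ⟨ihφ hφ.1 σ τ hpre h.1, ihψ hφ.2 σ τ hpre h.2⟩
  | ck G φ ih =>
    intro τ' hτ'
    obtain ⟨σ', hσ', hσσ'⟩ := GEquiv.exists_prefix hτ' hpre
    exact ih hφ σ' τ' hσ' (h σ' hσσ')

end Gossip
end

section
/- Let a and b be two distinct agents. If the call ab occurs in the call sequence σ, then (M, σ) ⊨ C_{ab} (F_a B ∧ F_b A), i.e., after a call between a and b it is common knowledge between a and b that a is familiar with b's secret and b is familiar with a's secret. -/
namespace Gossip

variable {A : Type} [DecidableEq A]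

theorem Call.isBetween_comm {c : Call A} {a b : A} : c.isBetween a b ↔ c.isBetween b a :=
  Or.comm

theorem Call.isBetween.involves {c : Call A} {a b : A} (h : c.isBetween a b) :
    c.involves a :=
  h.imp (fun h => h.1.symm) (fun h => h.2.symm)

theorem occursBetween_comm {a b : A} {σ : List (Call A)} :
    occursBetween a b σ ↔ occursBetween b a σ := by
  simp only [occursBetween, Call.isBetween_comm (a := a)]

theorem occursBetween_append_singleton {a b : A} {σ : List (Call A)} {c : Call A} :
    occursBetween a b (σ ++ [c]) ↔ occursBetween a b σ ∨ c.isBetween a b := by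
  simp only [occursBetween, List.mem_append, List.mem_singleton, or_and_right, exists_or,
    exists_eq_left]

/-- Agent `a` can tell whether a call with `b` has occurred. -/
theorem AgEquiv.occursBetween_iff {a b : A} {σ τ : List (Call A)} (h : AgEquiv a σ τ) :
    occursBetween a b σ ↔ occursBetween a b τ := by
  induction h with
  | nil => rfl
  | extLeft c hc _ ih =>
    rw [occursBetween_append_singleton, or_iff_left fun h => hc h.involves, ih]
  | extRight c hc _ ih =>
    rw [occursBetween_append_singleton, or_iff_left fun h => hc h.involves, ih]
  | call c _ _ _ ih => rw [occursBetween_append_singleton, occursBetween_append_singleton, ih]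

/-- It is common knowledge between `a` and `b` whether they have called each other. -/
theorem GEquiv.occursBetween_iff {a b : A} {σ τ : List (Call A)} (h : GEquiv {a, b} σ τ) :
    occursBetween a b σ ↔ occursBetween a b τ := by
  induction h with
  | refl => rfl
  | tail _ hστ ih =>
    obtain ⟨d, hd, hστ⟩ := hστ
    rw [ih]
    rcases Finset.mem_insert.1 hd with rfl | hd
    · exact hστ.occursBetween_iff
    · obtain rfl := Finset.mem_singleton.1 hd
      rw [occursBetween_comm, hστ.occursBetween_iff, occursBetween_comm]

theorem applySeq_append_singleton (σ : List (Call A)) (c : Call A) (s : A → Finset A) :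
    applySeq (σ ++ [c]) s = c.apply (applySeq σ s) := by
  simp [applySeq]

theorem Call.subset_apply (c : Call A) (s : A → Finset A) (d : A) : s d ⊆ c.apply s d := by
  unfold Call.apply
  split_ifs with h
  · rcases h with rfl | rfl
    exacts [Finset.subset_union_left, Finset.subset_union_right]
  · exact Finset.Subset.rfl

theorem Call.isBetween.subset_apply {c : Call A} {a b : A} (h : c.isBetween a b)
    (s : A → Finset A) : s b ⊆ c.apply s a := by
  rcases h with ⟨rfl, rfl⟩ | ⟨rfl, rfl⟩ <;> simp [Call.apply]

theorem mem_applySeq_root_self (σ : List (Call A)) (a : A) : a ∈ applySeq σ root a := by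
  induction σ using List.reverseRecOn with
  | nil => simp [applySeq, root]
  | append_singleton σ c ih =>
    rw [applySeq_append_singleton]
    exact c.subset_apply _ _ ih

theorem occursBetween.mem_applySeq_root {a b : A} {σ : List (Call A)}
    (h : occursBetween a b σ) : b ∈ applySeq σ root a := by
  induction σ using List.reverseRecOn with
  | nil => simp [occursBetween] at h
  | append_singleton σ c ih =>
    rw [applySeq_append_singleton]
    rcases occursBetween_append_singleton.1 h with h | h
    · exact c.subset_apply _ _ (ih h)
    · exact h.subset_apply _ (mem_applySeq_root_self σ b)

theorem stmt4 {A : Type} [DecidableEq A] [Fintype A] (hA : 3 ≤ Fintype.card A)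
    (a b : A) (hab : a ≠ b) (σ : List (Call A)) (h : occursBetween a b σ) :
    Sat (Formula.ck {a, b} (Formula.conj (Formula.fam a b) (Formula.fam b a))) σ := by
  intro τ hτ
  have hτ' := hτ.occursBetween_iff.1 h
  exact ⟨hτ'.mem_applySeq_root, (occursBetween_comm.1 hτ').mem_applySeq_root⟩

end Gossip
end
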